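/- The assignment sending the Γ₀(Np)-equivalence class of a form to its Γ₀(N)-equivalence class defines a bijection from P^{(D,r)}_{D₀,r₀}(N,p) onto P^{(Dp²,rp)}_{D₀,r₀}(N). In particular: (i) every form [a,b,c] with b² − 4ac = p²D₀D, b ≡ −p r₀ r (mod 2N), a ≡ 0 (mod Np²) and p ∤ c represents a class in P^{(Dp²,rp)}_{D₀,r₀}(N); (ii) two such forms are Γ₀(N)-equivalent if and only if they are Γ₀(Np)-equivalent; and (iii) every class in P^{(Dp²,rp)}_{D₀,r₀}(N) contains a form satisfying a ≡ 0 (mod Np²) and p ∤ c. -/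

import Mathlib

open Matrix

abbrev SL2Z := Matrix.SpecialLinearGroup (Fin 2) ℤ

/-- An integral binary quadratic form `[a,b,c] = a x² + b x y + c y²`. -/
@[ext]
structure QF where
  a : ℤ
  b : ℤ
  c : ℤ

/-- Right action of `SL₂(ℤ)` on binary quadratic forms:
`(Q|γ)(x,y) = Q(Ax + By, Cx + Dy)` for `γ = [[A,B],[C,D]]`. -/
def QF.act (Q : QF) (γ : SL2Z) : QF where
  a := Q.a * (γ.1 0 0)^2 + Q.b * (γ.1 0 0 * γ.1 1 0) + Q.c * (γ.1 1 0)^2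
  b := 2 * Q.a * (γ.1 0 0 * γ.1 0 1) + Q.b * (γ.1 0 0 * γ.1 1 1 + γ.1 0 1 * γ.1 1 0)
        + 2 * Q.c * (γ.1 1 0 * γ.1 1 1)
  c := Q.a * (γ.1 0 1)^2 + Q.b * (γ.1 0 1 * γ.1 1 1) + Q.c * (γ.1 1 1)^2

lemma QF.act_one (Q : QF) : Q.act 1 = Q := by
  ext <;> simp [QF.act, Matrix.SpecialLinearGroup.coe_one, Matrix.one_apply]

lemma QF.act_mul (Q : QF) (γ γ' : SL2Z) : Q.act (γ * γ') = (Q.act γ).act γ' := by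
  have h : ∀ i j, ((γ * γ' : SL2Z) : Matrix (Fin 2) (Fin 2) ℤ) i j
      = γ.1 i 0 * γ'.1 0 j + γ.1 i 1 * γ'.1 1 j := by
    intro i j
    rw [Matrix.SpecialLinearGroup.coe_mul, Matrix.mul_apply, Fin.sum_univ_two]
  ext <;> simp only [QF.act, h] <;> ring

lemma SL2Z_inv_entry (γ : SL2Z) : (γ⁻¹).1 1 0 = - γ.1 1 0 := by
  rw [Matrix.SpecialLinearGroup.SL2_inv_expl]
  simp

/-- `Γ₀(M)`-equivalence of binary quadratic forms. -/
def Gamma0Equiv (M : ℤ) (Q Q' : QF) : Prop :=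
  ∃ γ : SL2Z, M ∣ γ.1 1 0 ∧ Q.act γ = Q'

/-- `Γ₀(M)`-equivalence is an equivalence relation. -/
def gammaSetoid (M : ℤ) : Setoid QF where
  r := Gamma0Equiv M
  iseqv := by
    constructor
    · intro Q
      refine ⟨1, ?_, QF.act_one Q⟩
      simp [Matrix.SpecialLinearGroup.coe_one, Matrix.one_apply]
    · rintro Q Q' ⟨γ, hd, rfl⟩
      refine ⟨γ⁻¹, by rw [SL2Z_inv_entry]; exact hd.neg_right, ?_⟩
      rw [← QF.act_mul, mul_inv_cancel, QF.act_one]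
    · rintro Q Q' Q'' ⟨γ, hd, rfl⟩ ⟨γ', hd', rfl⟩
      refine ⟨γ * γ', ?_, QF.act_mul Q γ γ'⟩
      have h : ((γ * γ' : SL2Z) : Matrix (Fin 2) (Fin 2) ℤ) 1 0
          = γ.1 1 0 * γ'.1 0 0 + γ.1 1 1 * γ'.1 1 0 := by
        rw [Matrix.SpecialLinearGroup.coe_mul, Matrix.mul_apply, Fin.sum_univ_two]
      rw [h]
      exact dvd_add (hd.mul_right _) (hd'.mul_left _)

/-- The set of `Γ₀(M)`-equivalence classes of integral binary quadratic forms. -/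
abbrev QFClass (M : ℤ) := Quotient (gammaSetoid M)

/-- The `Γ₀(M)`-equivalence class of a form. -/
def QFClass.mk (M : ℤ) (Q : QF) : QFClass M := Quotient.mk (gammaSetoid M) Q

/-- The discriminant `b² - 4ac` of a binary quadratic form. -/
def QF.disc (Q : QF) : ℤ := Q.b^2 - 4 * Q.a * Q.c

/-- The defining conditions for membership in `F^{(D',r')}_{D₀,r₀}(N, p^s)`:
discriminant `p^{2s} D₀ D'`, `b ≡ -p^s r₀ r' (mod 2N)` and `a ≡ 0 (mod N p^{2s})`. -/
def memF (N p : ℤ) (s : ℕ) (D₀ r₀ D' r' : ℤ) (Q : QF) : Prop :=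
  Q.disc = p^(2*s) * D₀ * D' ∧ (2*N) ∣ (Q.b + p^s * r₀ * r') ∧ (N * p^(2*s)) ∣ Q.a

/-- The set `F^{(D',r')}_{D₀,r₀}(N, p^s)` of `Γ₀(M)`-classes (`M = N p^s`) of forms
satisfying the conditions `memF`. -/
def Fclasses (M N p : ℤ) (s : ℕ) (D₀ r₀ D' r' : ℤ) : Set (QFClass M) :=
  {cl | ∃ Q : QF, QFClass.mk M Q = cl ∧ memF N p s D₀ r₀ D' r' Q}

/-- The subset `P^{(D',r')}_{D₀,r₀}(N, p^s)` of `F^{(D',r')}_{D₀,r₀}(N, p^s)` of classes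
represented by a form `[a,b,c]` with `p ∤ c`. -/
def Pclasses (M N p : ℤ) (s : ℕ) (D₀ r₀ D' r' : ℤ) : Set (QFClass M) :=
  {cl | cl ∈ Fclasses M N p s D₀ r₀ D' r' ∧ ∃ Q : QF, QFClass.mk M Q = cl ∧ ¬ p ∣ Q.c}

/-- A form `[a,b,c]` is `p`-primitive if `p ∤ gcd(a,b,c)`. -/
def QF.pPrimitive (p : ℤ) (Q : QF) : Prop := ¬ (p ∣ Q.a ∧ p ∣ Q.b ∧ p ∣ Q.c)

/-- A class is `p`-primitive if it contains a `p`-primitive form. -/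
def pPrimClass (M p : ℤ) (cl : QFClass M) : Prop :=
  ∃ Q : QF, QFClass.mk M Q = cl ∧ Q.pPrimitive p

/-- `(D, r)` is an index `N` pair: `D < 0` and `D ≡ r² (mod 4N)`. -/
def IsIndexPair (N D r : ℤ) : Prop := D < 0 ∧ (4*N) ∣ (r^2 - D)

/-- `D` is a fundamental discriminant. -/
def IsFundamentalDiscriminant (D : ℤ) : Prop :=
  (D % 4 = 1 ∧ Squarefree D) ∨
    (D % 4 = 0 ∧ Squarefree (D / 4) ∧ (D / 4 % 4 = 2 ∨ D / 4 % 4 = 3))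

/-- The map on classes induced by coarsening the level `M` to a divisor `M'`. -/
def coarsen (M M' : ℤ) (h : M' ∣ M) : QFClass M → QFClass M' :=
  Quotient.lift (QFClass.mk M') (by
    rintro Q Q' ⟨γ, hd, hact⟩
    exact Quotient.sound ⟨γ, h.trans hd, hact⟩)

/-- The determinant relation for the entries of a matrix in `SL₂(ℤ)`. -/
lemma SL2Z_det (γ : SL2Z) : γ.1 0 0 * γ.1 1 1 - γ.1 0 1 * γ.1 1 0 = 1 := by
  rw [← Matrix.det_fin_two]
  exact γ.2

lemma QF.disc_act (Q : QF) (γ : SL2Z) : (Q.act γ).disc = Q.disc := by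
  have h : (Q.act γ).disc =
      Q.disc * (γ.1 0 0 * γ.1 1 1 - γ.1 0 1 * γ.1 1 0) ^ 2 := by
    simp only [QF.disc, QF.act]
    ring
  rw [h, SL2Z_det]
  ring

/-- The level `N` conditions are invariant under `Γ₀(N)`. -/
lemma memF_zero_act {N p D₀ r₀ D r : ℤ} {Q : QF} (h : memF N p 0 D₀ r₀ D r Q)
    {γ : SL2Z} (hγ : N ∣ γ.1 1 0) : memF N p 0 D₀ r₀ D r (Q.act γ) := by
  obtain ⟨hdisc, hb, ha⟩ := h
  refine ⟨by rw [QF.disc_act, hdisc], ?_, ?_⟩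
  · obtain ⟨k, hk⟩ := hb
    obtain ⟨l, hl⟩ := ha
    obtain ⟨m, hm⟩ := hγ
    have hdet := SL2Z_det γ
    refine ⟨k + l * γ.1 0 0 * γ.1 0 1 + Q.b * γ.1 0 1 * m + Q.c * m * γ.1 1 1, ?_⟩
    simp only [QF.act, hm] at hdet ⊢
    simp only [mul_zero, pow_zero, mul_one, one_mul] at hk hl ⊢
    linear_combination hk + 2 * γ.1 0 0 * γ.1 0 1 * hl + Q.b * hdet
  · simp only [mul_zero, pow_zero, mul_one] at ha ⊢
    exact dvd_add (dvd_add (ha.mul_right _) ((hγ.mul_left _).mul_left _))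
      ((dvd_pow hγ two_ne_zero).mul_left _)

lemma memF_one_iff {N p D₀ r₀ D r : ℤ} {Q : QF} :
    memF N p 1 D₀ r₀ D r Q ↔
      memF N p 0 D₀ r₀ (D * p ^ 2) (r * p) Q ∧ N * p ^ 2 ∣ Q.a := by
  have h₁ : p ^ (2 * 1) * D₀ * D = p ^ (2 * 0) * D₀ * (D * p ^ 2) := by ring
  have h₂ : Q.b + p ^ 1 * r₀ * r = Q.b + p ^ 0 * r₀ * (r * p) := by ring
  simp only [memF, h₁, h₂, mul_one, mul_zero, pow_zero]
  exact ⟨fun ⟨hd, hb, ha⟩ => ⟨⟨hd, hb, (dvd_mul_right _ _).trans ha⟩, ha⟩,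
    fun ⟨⟨hd, hb, _⟩, ha⟩ => ⟨hd, hb, ha⟩⟩

lemma memF.dvd_a {N p D₀ r₀ D r : ℤ} {Q : QF} (h : memF N p 1 D₀ r₀ D r Q) : p ∣ Q.a :=
  (dvd_pow_self p two_ne_zero).trans ((dvd_mul_left _ N).trans h.2.2)

lemma memF.dvd_b {N p D₀ r₀ D r : ℤ} (hp : Prime p) {Q : QF}
    (h : memF N p 1 D₀ r₀ D r Q) : p ∣ Q.b := by
  have hb : Q.b ^ 2 = p ^ (2 * 1) * D₀ * D + 4 * Q.a * Q.c := by
    rw [← h.1, QF.disc]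
    ring
  refine hp.dvd_of_dvd_pow (n := 2) ?_
  rw [hb]
  refine dvd_add (((dvd_pow_self p (by simp)).mul_right _).mul_right _) ?_
  exact (h.dvd_a.mul_left _).mul_right _

/-- Completing the square modulo `p`: a lower triangular element of `Γ₀(N)` makes
the leading coefficient divisible by `p²`. -/
lemma exists_act_memF_one {N p D₀ r₀ D r : ℤ} (hp : Prime p) (hp2 : ¬ p ∣ 2)
    (hpN : ¬ p ∣ N) {Q : QF} (h : memF N p 0 D₀ r₀ (D * p ^ 2) (r * p) Q)
    (hc : ¬ p ∣ Q.c) :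
    ∃ γ : SL2Z, N ∣ γ.1 1 0 ∧ memF N p 1 D₀ r₀ D r (Q.act γ) ∧ ¬ p ∣ (Q.act γ).c := by
  have hcop : IsCoprime p (2 * Q.c * N) :=
    (hp.coprime_iff_not_dvd).2 fun hd =>
      (hp.dvd_or_dvd hd).elim (fun hd => (hp.dvd_or_dvd hd).elim hp2 hc) hpN
  obtain ⟨u, v, huv⟩ := hcop
  let γ : SL2Z := ⟨!![1, 0; -(N * v * Q.b), 1], by simp⟩
  have hγ : N ∣ γ.1 1 0 := ⟨-(v * Q.b), by simp [γ]; ring⟩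
  have hmem := memF_zero_act h hγ
  have hcγ : (Q.act γ).c = Q.c := by simp [QF.act, γ]
  have hbγ : p ∣ (Q.act γ).b := by
    refine ⟨u * Q.b, ?_⟩
    simp [QF.act, γ]
    linear_combination (-Q.b) * huv
  rw [← hcγ] at hc
  refine ⟨γ, hγ, memF_one_iff.2 ⟨hmem, ?_⟩, hc⟩
  have hdvd : p ^ 2 ∣ (2 ^ 2 * (Q.act γ).c) * (Q.act γ).a := by
    have hdisc := hmem.1
    have he : (2 ^ 2 * (Q.act γ).c) * (Q.act γ).a =
        (Q.act γ).b ^ 2 - p ^ 2 * (D₀ * D) := by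
      simp only [QF.disc] at hdisc
      linear_combination -hdisc
    rw [he]
    exact dvd_sub (pow_dvd_pow_of_dvd hbγ 2) (dvd_mul_right _ _)
  have hcop' : IsCoprime (p ^ 2) (2 ^ 2 * (Q.act γ).c) :=
    (((hp.coprime_iff_not_dvd).2 hp2).pow).mul_right
      ((hp.coprime_iff_not_dvd).2 hc).pow_left
  have hNa : N ∣ (Q.act γ).a := by simpa using hmem.2.2
  exact (((hp.coprime_iff_not_dvd).2 hpN).pow_left.symm).mul_dvd hNa
    (hcop'.dvd_of_dvd_mul_left hdvd)

lemma Gamma0Equiv.level_mul {N p D₀ r₀ D r : ℤ} (hp : Prime p) (hpN : ¬ p ∣ N)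
    {Q Q' : QF} (h : memF N p 1 D₀ r₀ D r Q) (hc : ¬ p ∣ Q.c)
    (h' : memF N p 1 D₀ r₀ D r Q') (he : Gamma0Equiv N Q Q') :
    Gamma0Equiv (N * p) Q Q' := by
  obtain ⟨γ, hγ, rfl⟩ := he
  refine ⟨γ, ((hp.coprime_iff_not_dvd).2 hpN).symm.mul_dvd hγ ?_, rfl⟩
  have hd : p ∣ Q.c * (γ.1 1 0) ^ 2 :=
    (dvd_add_right (dvd_add (h.dvd_a.mul_right _) ((h.dvd_b hp).mul_right _))).1 h'.dvd_a
  exact hp.dvd_of_dvd_pow ((hp.dvd_or_dvd hd).resolve_left hc)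

lemma exists_memF_one_of_mem_Pclasses {N p D₀ r₀ D r : ℤ} (hp : Prime p)
    {cl : QFClass (N * p)} (h : cl ∈ Pclasses (N * p) N p 1 D₀ r₀ D r) :
    ∃ Q : QF, QFClass.mk (N * p) Q = cl ∧ memF N p 1 D₀ r₀ D r Q ∧ ¬ p ∣ Q.c := by
  obtain ⟨⟨Q, rfl, hQ⟩, Q', he, hc⟩ := h
  obtain ⟨γ, -, rfl⟩ : Gamma0Equiv (N * p) Q Q' := Quotient.exact he.symm
  refine ⟨Q, rfl, hQ, fun hd => hc ?_⟩
  exact dvd_add (dvd_add (hQ.dvd_a.mul_right _) ((hQ.dvd_b hp).mul_right _))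
    (hd.mul_right _)

lemma exists_memF_one_of_mem_Pclasses_zero {N p D₀ r₀ D r : ℤ} (hp : Prime p)
    (hp2 : ¬ p ∣ 2) (hpN : ¬ p ∣ N) {cl : QFClass N}
    (h : cl ∈ Pclasses N N p 0 D₀ r₀ (D * p ^ 2) (r * p)) :
    ∃ Q : QF, QFClass.mk N Q = cl ∧ memF N p 1 D₀ r₀ D r Q ∧ ¬ p ∣ Q.c := by
  obtain ⟨⟨Q, rfl, hQ⟩, Q', he, hc⟩ := h
  obtain ⟨γ, hγ, rfl⟩ : Gamma0Equiv N Q Q' := Quotient.exact he.symm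
  obtain ⟨δ, hδ, hmem, hc'⟩ := exists_act_memF_one hp hp2 hpN (memF_zero_act hQ hγ) hc
  exact ⟨_, (Quotient.sound ⟨δ, hδ, rfl⟩ : QFClass.mk N (Q.act γ) = _).symm.trans he,
    hmem, hc'⟩

lemma mk_mem_Pclasses_zero {N p D₀ r₀ D r : ℤ} {Q : QF}
    (h : memF N p 1 D₀ r₀ D r Q) (hc : ¬ p ∣ Q.c) :
    QFClass.mk N Q ∈ Pclasses N N p 0 D₀ r₀ (D * p ^ 2) (r * p) :=
  ⟨⟨Q, rfl, (memF_one_iff.1 h).1⟩, Q, rfl, hc⟩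

/-- Sending the `Γ₀(Np)`-class of a form to its `Γ₀(N)`-class defines a
bijection from `P^{(D,r)}_{D₀,r₀}(N,p)` onto `P^{(Dp²,rp)}_{D₀,r₀}(N)`.  In particular:
(i) every form `[a,b,c]` with `b² - 4ac = p²D₀D`, `b ≡ -p r₀ r (mod 2N)`,
`a ≡ 0 (mod Np²)` and `p ∤ c` represents a class in `P^{(Dp²,rp)}_{D₀,r₀}(N)`;
(ii) two such forms are `Γ₀(N)`-equivalent iff they are `Γ₀(Np)`-equivalent;
(iii) every class in `P^{(Dp²,rp)}_{D₀,r₀}(N)` contains a form with `a ≡ 0 (mod Np²)`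
and `p ∤ c`. -/
theorem classes_bijection_level_p
    (N p D₀ r₀ D r : ℤ) (hN : 1 ≤ N) (hNodd : Odd N)
    (hp : Prime p) (hp5 : 5 ≤ p) (hpN : ¬ p ∣ N)
    (hD₀ : IsIndexPair N D₀ r₀) (hfund : IsFundamentalDiscriminant D₀)
    (hD : IsIndexPair N D r) :
    Set.BijOn (coarsen (N * p) N ⟨p, rfl⟩)
      (Pclasses (N * p) N p 1 D₀ r₀ D r)
      (Pclasses N N p 0 D₀ r₀ (D * p^2) (r * p)) ∧
    -- (i)
    (∀ Q : QF, memF N p 1 D₀ r₀ D r Q → ¬ p ∣ Q.c →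
      QFClass.mk N Q ∈ Pclasses N N p 0 D₀ r₀ (D * p^2) (r * p)) ∧
    -- (ii)
    (∀ Q Q' : QF, memF N p 1 D₀ r₀ D r Q → ¬ p ∣ Q.c →
      memF N p 1 D₀ r₀ D r Q' → ¬ p ∣ Q'.c →
      (Gamma0Equiv N Q Q' ↔ Gamma0Equiv (N * p) Q Q')) ∧
    -- (iii)
    (∀ cl ∈ Pclasses N N p 0 D₀ r₀ (D * p^2) (r * p),
      ∃ Q : QF, QFClass.mk N Q = cl ∧ memF N p 1 D₀ r₀ D r Q ∧ ¬ p ∣ Q.c) := by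
  have hp2 : ¬ p ∣ 2 := fun h => by
    have := Int.le_of_dvd two_pos h
    omega
  refine ⟨⟨?_, ?_, ?_⟩, fun Q => mk_mem_Pclasses_zero, fun Q Q' hQ hc hQ' _ =>
    ⟨fun he => he.level_mul hp hpN hQ hc hQ',
      fun ⟨γ, hγ, he⟩ => ⟨γ, (dvd_mul_right N p).trans hγ, he⟩⟩,
    fun cl => exists_memF_one_of_mem_Pclasses_zero hp hp2 hpN⟩
  · intro cl hcl
    obtain ⟨Q, rfl, hQ, hc⟩ := exists_memF_one_of_mem_Pclasses hp hcl
    exact mk_mem_Pclasses_zero hQ hc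
  · intro cl hcl cl' hcl' he
    obtain ⟨Q, rfl, hQ, hc⟩ := exists_memF_one_of_mem_Pclasses hp hcl
    obtain ⟨Q', rfl, hQ', hc'⟩ := exists_memF_one_of_mem_Pclasses hp hcl'
    have he' : Gamma0Equiv N Q Q' := Quotient.exact he
    exact Quotient.sound (he'.level_mul hp hpN hQ hc hQ')
  · intro cl hcl
    obtain ⟨Q, rfl, hQ, hc⟩ := exists_memF_one_of_mem_Pclasses_zero hp hp2 hpN hcl
    exact ⟨QFClass.mk (N * p) Q, ⟨⟨Q, rfl, hQ⟩, Q, rfl, hc⟩, rfl⟩
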